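/- Let (R, m) be a commutative Noetherian local ring of depth t and let M be a finitely generated R-module with Ext^i_R(M, R) = 0 for all 1 ≤ i ≤ t−1. If F is a finitely generated free R-module, then F is a direct summand of M^* if and only if F is a direct summand of M. -/

import Mathlib

open IsLocalRing

universe u v

/-- The depth of a module `M` over a Noetherian local ring `(R, m)`: the supremum of the
lengths of `M`-regular sequences consisting of elements of `m`. -/
noncomputable def rdepth (R : Type*) (M : Type*) [CommRing R] [IsLocalRing R]
    [AddCommGroup M] [Module R M] : ℕ :=
  sSup {n : ℕ | ∃ rs : List R, rs.length = n ∧ (∀ r ∈ rs, r ∈ maximalIdeal R) ∧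
    RingTheory.Sequence.IsRegular M rs}

/-- `Deep(R)`: the class of finitely generated `R`-modules `M` with `depth_R(M) ≥ depth(R)`. -/
def Deep (R : Type*) (M : Type*) [CommRing R] [IsLocalRing R]
    [AddCommGroup M] [Module R M] : Prop :=
  Module.Finite R M ∧ rdepth R R ≤ rdepth R M

/-- `DF(R)` ("deeply faithful"): the class of finitely generated `R`-modules `M` admitting an
exact sequence `0 → R → M^{⊕n} → X → 0` with `X ∈ Deep(R)`. -/
def DF (R : Type u) (M : Type v) [CommRing R] [IsLocalRing R]
    [AddCommGroup M] [Module R M] : Prop :=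
  ∃ (n : ℕ) (X : Type v) (_ : AddCommGroup X) (_ : Module R X)
    (f : R →ₗ[R] (Fin n → M)) (g : (Fin n → M) →ₗ[R] X),
      Function.Injective f ∧ Function.Surjective g ∧ Function.Exact f g ∧ Deep R X

/-- The Ext module `Ext^n_R(M, N)`, via the derived functor `Ext` of Mathlib. -/
noncomputable abbrev extModule (R : Type u) [CommRing R] (M N : Type u)
    [AddCommGroup M] [Module R M] [AddCommGroup N] [Module R N] (n : ℕ) : ModuleCat.{u} R :=
  ((Ext R (ModuleCat.{u} R) n).obj (Opposite.op (ModuleCat.of R M))).obj (ModuleCat.of R N)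


/-- `F` is a direct summand of `M`: there is a split injection `F → M`. -/
def IsDirectSummand (R : Type u) (F M : Type v) [CommRing R]
    [AddCommGroup F] [Module R F] [AddCommGroup M] [Module R M] : Prop :=
  ∃ (f : F →ₗ[R] M) (g : M →ₗ[R] F), g ∘ₗ f = LinearMap.id

open RingTheory.Sequence CategoryTheory Pointwise

section

variable {R : Type*} [CommRing R]

/-- A linear map landing in `r • N`, with `r` regular on `N`, is divisible by `r`. -/
lemma LinearMap.exists_eq_smul_of_mkQ_comp_eq_zero {M N : Type*} [AddCommGroup M] [Module R M]
    [AddCommGroup N] [Module R N] {r : R} (hr : IsSMulRegular N r) (f : M →ₗ[R] N)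
    (hf : (r • (⊤ : Submodule R N)).mkQ ∘ₗ f = 0) : ∃ h : M →ₗ[R] N, f = r • h := by
  have hmem (x : M) : f x ∈ LinearMap.range (LinearMap.lsmul R N r) := by
    have hx : f x ∈ r • (⊤ : Submodule R N) := by
      simpa using LinearMap.congr_fun hf x
    obtain ⟨y, -, hy⟩ := (Submodule.mem_smul_pointwise_iff_exists _ _ _).1 hx
    exact ⟨y, hy⟩
  let e := LinearEquiv.ofInjective (LinearMap.lsmul R N r) hr
  refine ⟨e.symm.toLinearMap ∘ₗ f.codRestrict _ hmem, LinearMap.ext fun x ↦ ?_⟩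
  have := congrArg Subtype.val (e.apply_symm_apply (f.codRestrict _ hmem x))
  exact this.symm

/-- For a sequence `P (n + 2) → P (n + 1) → P n` of modules, every cocycle `P (n + 1) → N`
is a coboundary; for a projective resolution this says `Ext^(n + 1) = 0`. -/
def CocyclesExtend {P : ℕ → Type*} [∀ n, AddCommGroup (P n)] [∀ n, Module R (P n)]
    (d : ∀ n, P (n + 1) →ₗ[R] P n) (N : Type*) [AddCommGroup N] [Module R N] (n : ℕ) : Prop :=
  ∀ f : P (n + 1) →ₗ[R] N, f ∘ₗ d (n + 1) = 0 → ∃ g : P n →ₗ[R] N, f = g ∘ₗ d n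

variable {P : ℕ → Type*} [∀ n, AddCommGroup (P n)] [∀ n, Module R (P n)]
  [∀ n, Module.Projective R (P n)] {d : ∀ n, P (n + 1) →ₗ[R] P n}

/-- If the first positive cohomology vanishes, cochains killed by the differential modulo `r` lift
to cochains killed by the differential. -/
lemma CocyclesExtend.exists_lift {N : Type*} [AddCommGroup N] [Module R N] {r : R}
    (hr : IsSMulRegular N r) {n : ℕ} (hdd : d n ∘ₗ d (n + 1) = 0) (hN : CocyclesExtend d N n)
    (f : P n →ₗ[R] QuotSMulTop r N) (hf : f ∘ₗ d n = 0) :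
    ∃ g : P n →ₗ[R] N, (r • (⊤ : Submodule R N)).mkQ ∘ₗ g = f ∧ g ∘ₗ d n = 0 := by
  obtain ⟨h, hh⟩ := Module.projective_lifting_property (r • (⊤ : Submodule R N)).mkQ f
    (Submodule.mkQ_surjective _)
  obtain ⟨k, hk⟩ := LinearMap.exists_eq_smul_of_mkQ_comp_eq_zero hr (h ∘ₗ d n)
    (by rw [← LinearMap.comp_assoc, hh, hf])
  obtain ⟨l, hl⟩ := hN k (by
    ext x
    apply hr
    have h1 := LinearMap.congr_fun hk (d (n + 1) x)
    have h2 := LinearMap.congr_fun hdd x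
    simp only [LinearMap.comp_apply, LinearMap.zero_apply, LinearMap.smul_apply] at h1 h2 ⊢
    rw [← h1, h2, map_zero, smul_zero])
  refine ⟨h - r • l, ?_, ?_⟩
  · rw [LinearMap.comp_sub, hh, sub_eq_self]
    ext x
    exact (Submodule.Quotient.mk_eq_zero _).2 (Submodule.smul_mem_pointwise_smul (l x) r ⊤ trivial)
  · rw [LinearMap.sub_comp, hk, hl, LinearMap.smul_comp, sub_self]

lemma CocyclesExtend.quotSMulTop {N : Type*} [AddCommGroup N] [Module R N] {r : R}
    (hr : IsSMulRegular N r) {n : ℕ} (hdd : d (n + 1) ∘ₗ d (n + 2) = 0)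
    (h₁ : CocyclesExtend d N n) (h₂ : CocyclesExtend d N (n + 1)) :
    CocyclesExtend d (QuotSMulTop r N) n := by
  intro f hf
  obtain ⟨g, hg, hgd⟩ := h₂.exists_lift hr hdd f hf
  obtain ⟨k, rfl⟩ := h₁ g hgd
  exact ⟨(r • (⊤ : Submodule R N)).mkQ ∘ₗ k, hg.symm⟩

/-- Homomorphisms `M → N` with values in `(r₁, …, rₜ) N` lie in `(r₁, …, rₜ) Hom(M, N)`, when the
sequence is weakly `N`-regular and `Ext^i(M, N) = 0` for `1 ≤ i ≤ t - 1`. -/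
lemma LinearMap.mem_ofList_smul_top_of_isWeaklyRegular {M : Type*} [AddCommGroup M] [Module R M]
    (hdd : ∀ n, d n ∘ₗ d (n + 1) = 0) {ε : P 0 →ₗ[R] M} (hε : Function.Surjective ε)
    (hdε : Function.Exact (d 0) ε) (rs : List R) {N : Type*} [AddCommGroup N] [Module R N]
    (hrs : IsWeaklyRegular N rs) (hN : ∀ n, n + 1 < rs.length → CocyclesExtend d N n)
    (f : M →ₗ[R] N) (hf : ∀ x, f x ∈ Ideal.ofList rs • (⊤ : Submodule R N)) :
    f ∈ Ideal.ofList rs • (⊤ : Submodule R (M →ₗ[R] N)) := by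
  induction rs generalizing N with
  | nil =>
    have : f = 0 := by ext x; simpa using hf x
    simp [this]
  | cons r rs ih =>
    obtain ⟨hr, hrs⟩ := (isWeaklyRegular_cons_iff _ _ _).1 hrs
    let q := (r • (⊤ : Submodule R N)).mkQ
    have hq : q ∘ₗ f ∈ Ideal.ofList rs • (⊤ : Submodule R (M →ₗ[R] QuotSMulTop r N)) := by
      refine ih hrs (fun n hn ↦ ?_) _ fun x ↦ ?_
      · exact (hN n (by simp; omega)).quotSMulTop hr (hdd _) (hN (n + 1) (by simpa using hn))
      · have := Submodule.mem_map_of_mem (f := q) (hf x)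
        rw [Ideal.ofList_cons, Submodule.sup_smul, Submodule.map_sup, Submodule.map_smul'',
          Submodule.map_smul'', Submodule.ideal_span_singleton_smul] at this
        have h0 : r • Submodule.map q ⊤ = ⊥ := by
          rw [← Submodule.map_pointwise_smul]
          exact Submodule.mkQ_map_self _
        rw [h0, bot_sup_eq] at this
        exact Submodule.smul_mono le_rfl le_top this
    have hlift : ∃ k ∈ Ideal.ofList rs • (⊤ : Submodule R (M →ₗ[R] N)), q ∘ₗ k = q ∘ₗ f := by
      rcases rs.eq_nil_or_concat' with rfl | ⟨rs', a, hrs'⟩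
      · refine ⟨0, zero_mem _, ?_⟩
        simpa [eq_comm] using hq
      · have hsurj : Function.Surjective (LinearMap.compRight R q :
            (M →ₗ[R] N) → (M →ₗ[R] QuotSMulTop r N)) := by
          intro h
          have hεd : ε ∘ₗ d 0 = 0 := hdε.linearMap_comp_eq_zero
          obtain ⟨g, hg, hgd⟩ := (hN 0 (by simp [hrs'])).exists_lift hr (hdd 0) (h ∘ₗ ε)
            (by rw [LinearMap.comp_assoc, hεd, LinearMap.comp_zero])
          have hker : LinearMap.ker ε ≤ LinearMap.ker g := by
            rw [LinearMap.exact_iff.1 hdε]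
            rintro _ ⟨y, rfl⟩
            exact LinearMap.congr_fun hgd y
          refine ⟨(LinearMap.ker ε).liftQ g hker ∘ₗ
            (ε.quotKerEquivOfSurjective hε).symm.toLinearMap, ?_⟩
          ext x
          obtain ⟨y, rfl⟩ := hε x
          have : (ε.quotKerEquivOfSurjective hε).symm (ε y) = Submodule.Quotient.mk y := by
            rw [LinearEquiv.symm_apply_eq]; rfl
          simp only [LinearMap.compRight_apply, LinearMap.comp_apply, LinearEquiv.coe_coe, this]
          exact LinearMap.congr_fun hg y
        have : q ∘ₗ f ∈ (Ideal.ofList rs • (⊤ : Submodule R (M →ₗ[R] N))).map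
            (LinearMap.compRight R q (M := M)) := by
          rwa [Submodule.map_smul'', Submodule.map_top, LinearMap.range_eq_top.2 hsurj]
        exact this
    obtain ⟨k, hk, hkf⟩ := hlift
    obtain ⟨h, hh⟩ := LinearMap.exists_eq_smul_of_mkQ_comp_eq_zero hr (f - k)
      (by rw [LinearMap.comp_sub, sub_eq_zero]; exact hkf.symm)
    rw [← sub_add_cancel f k, hh, Ideal.ofList_cons, Submodule.sup_smul]
    refine Submodule.add_mem_sup ?_ hk
    exact Submodule.smul_mem_smul (Ideal.mem_span_singleton_self r) trivial

end

section

variable {R : Type*} [CommRing R] [IsNoetherianRing R] [IsLocalRing R]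

variable (R) in
lemma bddAbove_length_isRegular : BddAbove {n : ℕ | ∃ rs : List R, rs.length = n ∧
    (∀ r ∈ rs, r ∈ maximalIdeal R) ∧ IsRegular R rs} := by
  obtain ⟨e, he⟩ := WithBot.ne_bot_iff_exists.1 (ringKrullDim_ne_bot (R := R))
  obtain ⟨d, rfl⟩ := ENat.ne_top_iff_exists.1 (a := e ≠ ⊤) (by
    rintro rfl
    exact ringKrullDim_ne_top (R := R) he.symm)
  refine ⟨d, ?_⟩
  rintro _ ⟨rs, rfl, -, hreg⟩
  have h := ringKrullDim_add_length_eq_ringKrullDim_of_isRegular rs hreg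
  have : Nontrivial (R ⧸ Ideal.ofList rs) :=
    Ideal.Quotient.nontrivial_iff.2 fun h ↦ hreg.top_ne_smul (by simp [h])
  have h0 : 0 ≤ ringKrullDim (R ⧸ Ideal.ofList rs) := ringKrullDim_nonneg_of_nontrivial
  have h1 : (rs.length : WithBot ℕ∞) ≤ d := by
    refine le_trans ?_ (h.trans he.symm).le
    exact le_add_of_nonneg_left h0
  exact_mod_cast h1

variable (R) in
lemma exists_isRegular_length_eq_rdepth : ∃ rs : List R, rs.length = rdepth R R ∧
    (∀ r ∈ rs, r ∈ maximalIdeal R) ∧ IsRegular R rs :=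
  Nat.sSup_mem (s := {n : ℕ | ∃ rs : List R, rs.length = n ∧
    (∀ r ∈ rs, r ∈ maximalIdeal R) ∧ IsRegular R rs})
    ⟨0, [], rfl, by simp, IsRegular.nil R R⟩ (bddAbove_length_isRegular R)

/-- Modulo a regular sequence of maximal length, the socle of `R` is nonzero. -/
lemma exists_notMem_ofList_of_length_eq_rdepth {rs : List R} (hlen : rs.length = rdepth R R)
    (hmem : ∀ r ∈ rs, r ∈ maximalIdeal R) (hreg : IsRegular R rs) :
    ∃ s, s ∉ Ideal.ofList rs ∧ ∀ a ∈ maximalIdeal R, a * s ∈ Ideal.ofList rs := by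
  let N := R ⧸ (Ideal.ofList rs • (⊤ : Submodule R R))
  have hzd : (maximalIdeal R : Set R) ⊆ ⋃ p ∈ associatedPrimes R N, p := by
    rw [biUnion_associatedPrimes_eq_zero_divisors]
    intro a ha
    by_contra hcon
    have hna : IsSMulRegular N a := by
      rw [isSMulRegular_iff_right_eq_zero_of_smul]
      exact fun x hx ↦ by_contra fun hx0 ↦ hcon ⟨x, hx0, hx⟩
    have hmem' : ∀ r ∈ rs ++ [a], r ∈ maximalIdeal R := by
      simpa [or_imp, forall_and] using And.intro hmem ha
    have hlong : IsRegular R (rs ++ [a]) := by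
      rw [isRegular_iff_isWeaklyRegular_of_subset_maximalIdeal hmem', isWeaklyRegular_append_iff]
      exact ⟨hreg.toIsWeaklyRegular, (isWeaklyRegular_singleton_iff _ _).2 hna⟩
    have : (rs ++ [a]).length ≤ rdepth R R :=
      le_csSup (bddAbove_length_isRegular R) ⟨_, rfl, hmem', hlong⟩
    simp [hlen] at this
  have hfin := associatedPrimes.finite R N
  obtain ⟨p, hp, hle⟩ := (Ideal.subset_union_prime (s := hfin.toFinset) (f := id) ⊥ ⊥
    (fun p hp _ _ ↦ ((hfin.mem_toFinset).1 hp).isPrime)).1 (by simpa using hzd)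
  obtain ⟨hprime, x, hx⟩ := isAssociatedPrime_iff.1 (hfin.mem_toFinset.1 hp)
  obtain ⟨s, rfl⟩ := Submodule.Quotient.mk_surjective _ x
  have hcolon (a : R) : a ∈ p ↔ a * s ∈ Ideal.ofList rs := by
    rw [hx, Submodule.mem_colon_singleton, ← Submodule.Quotient.mk_smul, Submodule.mem_bot,
      Submodule.Quotient.mk_eq_zero]
    simp
  refine ⟨s, fun hs ↦ hprime.ne_top ((Ideal.eq_top_iff_one _).2 ?_), fun a ha ↦ ?_⟩
  · rw [hcolon, one_mul]; exact hs
  · exact (hcolon a).1 (hle ha)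

end

/-- Vanishing of `Ext^(n + 1)(M, N)`, read off from a projective resolution of `M`. -/
lemma CategoryTheory.ProjectiveResolution.cocyclesExtend {R : Type u} [CommRing R]
    {M : Type u} [AddCommGroup M] [Module R M]
    (Q : ProjectiveResolution (ModuleCat.of R M)) (N : Type u) [AddCommGroup N] [Module R N] (n : ℕ)
    (h : Subsingleton (extModule R M N (n + 1))) :
    CocyclesExtend (P := fun n ↦ Q.complex.X n) (fun n ↦ (Q.complex.d (n + 1) n).hom) N n := by
  have h0 := (ModuleCat.isZero_of_subsingleton (extModule R M N (n + 1))).of_iso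
    (Q.isoExt (R := R) (n + 1) (ModuleCat.of R N)).symm
  rw [← HomologicalComplex.exactAt_iff_isZero_homology,
    HomologicalComplex.exactAt_iff' _ n (n + 1) (n + 2) (by simp) (by simp),
    ShortComplex.moduleCat_exact_iff] at h0
  intro f hf
  obtain ⟨g, hg⟩ := h0 (ModuleCat.ofHom f) (ModuleCat.hom_ext hf)
  refine ⟨ModuleCat.Hom.hom g, ?_⟩
  exact congrArg ModuleCat.Hom.hom hg.symm

/-- If `Ext^i(M, R) = 0` for `1 ≤ i ≤ depth R - 1` and `φ : M → R` takes values in `m`, then every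
functional on the dual of `M` sends `φ` into `m`. -/
lemma apply_mem_maximalIdeal_of_forall_mem {R : Type u} [CommRing R] [IsNoetherianRing R]
    [IsLocalRing R] {M : Type u} [AddCommGroup M] [Module R M]
    (hvanish : ∀ i : ℕ, 1 ≤ i → i ≤ rdepth R R - 1 → Subsingleton (extModule R M R i))
    (φ : M →ₗ[R] R) (hφ : ∀ x, φ x ∈ maximalIdeal R) (g : (M →ₗ[R] R) →ₗ[R] R) :
    g φ ∈ maximalIdeal R := by
  obtain ⟨rs, hlen, hmem, hreg⟩ := exists_isRegular_length_eq_rdepth R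
  obtain ⟨s, hs, hsm⟩ := exists_notMem_ofList_of_length_eq_rdepth hlen hmem hreg
  let Q := projectiveResolution (ModuleCat.of R M)
  have (n : ℕ) : Module.Projective R (Q.complex.X n) :=
    (IsProjective.iff_projective _).2 (Q.projective n)
  have hmem' : s • φ ∈ Ideal.ofList rs • (⊤ : Submodule R (M →ₗ[R] R)) :=
    LinearMap.mem_ofList_smul_top_of_isWeaklyRegular
    (P := fun n ↦ Q.complex.X n) (d := fun n ↦ (Q.complex.d (n + 1) n).hom)
    (ε := (Q.π.f 0).hom) (M := M)
    (fun n ↦ congrArg ModuleCat.Hom.hom (Q.complex.d_comp_d (n + 2) (n + 1) n))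
    ((ModuleCat.epi_iff_surjective _).1 inferInstance)
    ((ShortComplex.ShortExact.moduleCat_exact_iff_function_exact
      (ShortComplex.mk _ _ Q.complex_d_comp_π_f_zero)).1 Q.exact₀)
    rs hreg.toIsWeaklyRegular
    (fun n hn ↦ Q.cocyclesExtend R n (hvanish _ (by omega) (by omega))) (s • φ)
    (fun x ↦ by
      have hx : s * φ x ∈ Ideal.ofList rs := mul_comm (φ x) s ▸ hsm _ (hφ x)
      rw [smul_eq_mul, Ideal.mul_top]
      exact hx)
  by_contra hu
  have hgs := Submodule.mem_map_of_mem (f := g) hmem'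
  rw [Submodule.map_smul'', map_smul, smul_eq_mul] at hgs
  have : s * g φ ∈ Ideal.ofList rs := by
    have := Submodule.smul_mono le_rfl le_top hgs
    simpa using this
  have hunit : IsUnit (g φ) := by simpa using hu
  exact hs ((Ideal.mul_unit_mem_iff_mem _ hunit).1 this)

/-- If a map into the dual of a finite free module over a local ring is not surjective, then after
evaluation at some vector outside `m F` it takes values in `m`. -/
lemma exists_forall_apply_mem_maximalIdeal_of_not_surjective {R : Type*} [CommRing R]
    [IsLocalRing R] {M F : Type*} [AddCommGroup M] [Module R M] [AddCommGroup F] [Module R F]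
    [Module.Free R F] [Module.Finite R F] {Φ : M →ₗ[R] F →ₗ[R] R}
    (hΦ : ¬ Function.Surjective Φ) :
    ∃ y : F, (∀ x, Φ x y ∈ maximalIdeal R) ∧ ∃ ψ : F →ₗ[R] R, ψ y ∉ maximalIdeal R := by
  classical
  obtain ⟨N, hN, hle⟩ := (eq_top_or_exists_le_coatom (LinearMap.range Φ)).resolve_left
    (mt LinearMap.range_eq_top.1 hΦ)
  have := isSimpleModule_iff_isCoatom.2 hN
  obtain ⟨I, hI, ⟨e⟩⟩ := (isSimpleModule_iff_quot_maximal (R := R)).1 this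
  obtain rfl := IsLocalRing.eq_maximalIdeal hI
  let b := Module.Free.chooseBasis R F
  choose a ha using fun i ↦ Ideal.Quotient.mk_surjective (e (N.mkQ (b.coord i)))
  have key (ψ : F →ₗ[R] R) : ψ (∑ i, a i • b i) ∈ maximalIdeal R ↔ ψ ∈ N := by
    have hψ : ψ = ∑ i, ψ (b i) • b.coord i := b.ext fun j ↦ by
      simp
    have : e (N.mkQ ψ) = Ideal.Quotient.mk _ (ψ (∑ i, a i • b i)) := by
      conv_lhs => rw [hψ]
      simp only [map_sum, map_smul, ← ha, smul_eq_mul, map_mul, Algebra.smul_def,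
        Ideal.Quotient.algebraMap_eq, mul_comm]
    rw [← Ideal.Quotient.eq_zero_iff_mem, ← this, LinearEquiv.map_eq_zero_iff,
      Submodule.mkQ_apply, Submodule.Quotient.mk_eq_zero]
  refine ⟨_, fun x ↦ (key _).2 (hle ⟨x, rfl⟩), ?_⟩
  by_contra! h
  exact hN.1 (eq_top_iff.2 fun ψ _ ↦ (key ψ).1 (h ψ))

/-- Let `(R, m)` be a commutative Noetherian local ring of depth `t` and let
`M` be a finitely generated `R`-module with `Ext^i_R(M, R) = 0` for all `1 ≤ i ≤ t−1`.  If `F` is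
a finitely generated free `R`-module, then `F` is a direct summand of `M^*` iff `F` is a direct
summand of `M`. -/
theorem free_summand_dual_iff {R : Type u} [CommRing R] [IsNoetherianRing R] [IsLocalRing R]
    (M : Type u) [AddCommGroup M] [Module R M] [Module.Finite R M]
    (F : Type u) [AddCommGroup F] [Module R F] [Module.Free R F] [Module.Finite R F]
    (hvanish : ∀ i : ℕ, 1 ≤ i → i ≤ rdepth R R - 1 → Subsingleton (extModule R M R i)) :
    IsDirectSummand R F (M →ₗ[R] R) ↔ IsDirectSummand R F M := by
  classical
  let e := (Module.Free.chooseBasis R F).toDualEquiv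
  constructor
  · rintro ⟨f, g, hgf⟩
    have hsurj : Function.Surjective f.flip := by
      by_contra hcon
      obtain ⟨y, hy, ψ, hψ⟩ := exists_forall_apply_mem_maximalIdeal_of_not_surjective hcon
      have := apply_mem_maximalIdeal_of_forall_mem hvanish (f y) hy (ψ ∘ₗ g)
      rw [LinearMap.comp_apply, ← LinearMap.comp_apply g, hgf] at this
      exact hψ this
    obtain ⟨s, hs⟩ := Module.projective_lifting_property f.flip e.toLinearMap hsurj
    refine ⟨s, e.symm.toLinearMap ∘ₗ f.flip, ?_⟩
    rw [LinearMap.comp_assoc, hs]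
    ext; simp
  · rintro ⟨f, g, hgf⟩
    refine ⟨LinearMap.lcomp R R g ∘ₗ e.toLinearMap, e.symm.toLinearMap ∘ₗ LinearMap.lcomp R R f, ?_⟩
    ext y
    have : (e y ∘ₗ g) ∘ₗ f = e y := by rw [LinearMap.comp_assoc, hgf, LinearMap.comp_id]
    exact (congrArg e.symm this).trans (e.symm_apply_apply y)
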